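/- For all integers N ≥ 2 and M ≥ 2, Player 2 has a winning strategy in reversed Chomp on the N×M board; that is, the starting state {(1,1)} is not a first-player win. -/

import Mathlib

/-- A state of reversed Chomp on the `N × M` board: a lower set of squares
inside `{1,…,N} × {1,…,M}` containing the poisoned square `(1,1)`. -/
def IsChompState (N M : ℕ) (S : Finset (ℕ × ℕ)) : Prop :=
  (1, 1) ∈ S ∧
  (∀ p ∈ S, 1 ≤ p.1 ∧ p.1 ≤ N ∧ 1 ≤ p.2 ∧ p.2 ≤ M) ∧
  (∀ p ∈ S, ∀ q : ℕ × ℕ, 1 ≤ q.1 → q.1 ≤ p.1 → 1 ≤ q.2 → q.2 ≤ p.2 → q ∈ S)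

/-- A legal move of reversed Chomp on the `N × M` board: enlarge the state `S`
to a strictly larger state `S'` such that the added squares are exactly the
squares of `S'` above and to the right of some square `(x, y)`. -/
def ChompMove (N M : ℕ) (S S' : Finset (ℕ × ℕ)) : Prop :=
  IsChompState N M S ∧ IsChompState N M S' ∧ S ⊂ S' ∧
  ∃ x y : ℕ, S' \ S = S'.filter (fun p => x ≤ p.1 ∧ y ≤ p.2)

mutual
  /-- The state is a first-player win: some legal move leads to a state that is a
  loss for the player then to move. -/
  inductive ChompFirstWin (N M : ℕ) : Finset (ℕ × ℕ) → Prop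
    | intro (S S' : Finset (ℕ × ℕ)) (m : ChompMove N M S S') (hl : ChompLoss N M S') :
        ChompFirstWin N M S
  /-- The state is a loss for the player to move (i.e., not a first-player win):
  every legal move leads to a first-player win for the opponent. -/
  inductive ChompLoss (N M : ℕ) : Finset (ℕ × ℕ) → Prop
    | intro (S : Finset (ℕ × ℕ)) (hall : ∀ S', ChompMove N M S S' → ChompFirstWin N M S') :
        ChompLoss N M S
end

def chompQ (N M x y : ℕ) : Finset (ℕ × ℕ) :=
  (Finset.Icc 1 N ×ˢ Finset.Icc 1 M).filter
    (fun p => p.1 < x ∨ p.2 < y ∨ (p.1 = x ∧ p.2 = y))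

theorem mem_chompQ (N M x y i j : ℕ) : (i, j) ∈ chompQ N M x y ↔
    (1 ≤ i ∧ i ≤ N ∧ 1 ≤ j ∧ j ≤ M) ∧ (i < x ∨ j < y ∨ (i = x ∧ j = y)) := by
  simp [chompQ]; tauto

theorem chompQ_state (N M x y : ℕ) (hx : 1 ≤ x) (hy : 1 ≤ y) (hN : 1 ≤ N) (hM : 1 ≤ M) :
    IsChompState N M (chompQ N M x y) := by
  refine ⟨?_, ?_, ?_⟩
  · rw [mem_chompQ]; omega
  · rintro ⟨i, j⟩ h; rw [mem_chompQ] at h; dsimp only; omega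
  · rintro ⟨i, j⟩ h ⟨a, b⟩; rw [mem_chompQ] at h ⊢; dsimp only; omega

theorem chomp_move_mk (N M x y i j : ℕ) (S T : Finset (ℕ × ℕ)) (hS : IsChompState N M S)
    (hT : IsChompState N M T) (hij : (i, j) ∈ T) (hij' : (i, j) ∉ S)
    (hsub : ∀ a b, (a, b) ∈ S → (a, b) ∈ T)
    (h : ∀ a b, (a, b) ∈ T → ((a, b) ∉ S ↔ x ≤ a ∧ y ≤ b)) : ChompMove N M S T := by
  refine ⟨hS, hT, ⟨fun p hp => hsub p.1 p.2 hp, fun hh => hij' (hh hij)⟩, x, y, ?_⟩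
  ext ⟨a, b⟩
  simp only [Finset.mem_sdiff, Finset.mem_filter]
  constructor
  · rintro ⟨h1, h2⟩; exact ⟨h1, (h a b h1).1 h2⟩
  · rintro ⟨h1, h2⟩; exact ⟨h1, (h a b h1).2 h2⟩

theorem chomp_full_not_win (N M : ℕ) (T : Finset (ℕ × ℕ))
    (hT : ∀ i j, 1 ≤ i → i ≤ N → 1 ≤ j → j ≤ M → (i, j) ∈ T) : ¬ ChompFirstWin N M T := by
  rintro ⟨_, S', ⟨_, h2, h3, _⟩, _⟩
  apply h3.2
  rintro ⟨i, j⟩ hp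
  obtain ⟨a, b, c, d⟩ := h2.2.1 _ hp
  exact hT i j a b c d

theorem chompQ_not_win (N M : ℕ) : ∀ n x y : ℕ, (N - x) + (M - y) = n → 1 ≤ x → x < N →
    1 ≤ y → y < M → ¬ ChompFirstWin N M (chompQ N M x y) := by
  intro n
  induction n using Nat.strong_induction_on with
  | _ n ih =>
  intro x y hn hx hxN hy hyM hw
  obtain ⟨_, S', ⟨h1, h2, h3, u, v, huv⟩, ⟨_, hall⟩⟩ := hw
  have hsub : ∀ i j, (i, j) ∈ chompQ N M x y → (i, j) ∈ S' := fun i j h => h3.1 h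
  have hbd : ∀ i j, (i, j) ∈ S' → 1 ≤ i ∧ i ≤ N ∧ 1 ≤ j ∧ j ≤ M := fun i j h => h2.2.1 _ h
  have hlow : ∀ i j a b, (i, j) ∈ S' → 1 ≤ a → a ≤ i → 1 ≤ b → b ≤ j → (a, b) ∈ S' :=
    fun i j a b h p q r s => h2.2.2 _ h (a, b) p q r s
  have hd : ∀ i j, ((i, j) ∈ S' ∧ (i, j) ∉ chompQ N M x y) ↔ ((i, j) ∈ S' ∧ u ≤ i ∧ v ≤ j) := by
    intro i j
    have := congrArg (fun s => (i, j) ∈ s) huv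
    simpa only [Finset.mem_sdiff, Finset.mem_filter, eq_iff_iff] using this
  obtain ⟨⟨i0, j0⟩, hp, hp'⟩ := Finset.exists_of_ssubset h3
  simp only [mem_chompQ] at hsub hd hp'
  have hxy : (x, y) ∈ S' := hsub x y (by omega)
  have hnb : ¬ ((x + 1, y) ∈ S' ∧ (x, y + 1) ∈ S') := by
    rintro ⟨ha, hb⟩
    have e1 := (hd _ _).1 ⟨ha, by omega⟩
    have e2 := (hd _ _).1 ⟨hb, by omega⟩
    have := ((hd x y).2 ⟨hxy, by omega⟩).2
    omega
  have b0 := hbd _ _ hp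
  -- a reply `T` that is not a first-player win
  suffices H : ∃ T, ChompMove N M S' T ∧ ¬ ChompFirstWin N M T by
    obtain ⟨T, hT, hT'⟩ := H
    exact hT' (hall T hT)
  by_cases hc : (x, y + 1) ∈ S'
  · have hr : (x + 1, y) ∉ S' := fun h => hnb ⟨h, hc⟩
    have hnot : ∀ i j, (i, j) ∈ S' → ¬ (x + 1 ≤ i ∧ y ≤ j) := fun i j h ⟨p, q⟩ =>
      hr (hlow i j _ _ h (by omega) p hy q)
    obtain ⟨k, hk, hkmax⟩ : ∃ k, (x, k) ∈ S' ∧ ∀ j, (x, j) ∈ S' → j ≤ k := by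
      classical
      refine ⟨Nat.findGreatest (fun j => (x, j) ∈ S') M, ?_, ?_⟩
      · exact Nat.findGreatest_spec (P := fun j => (x, j) ∈ S') (m := y) (by omega) hxy
      · intro j hj
        exact Nat.le_findGreatest (hbd _ _ hj).2.2.2 hj
    have hyk : y + 1 ≤ k := hkmax _ hc
    have hkM := (hbd _ _ hk).2.2.2
    have hS : ∀ i j, (i, j) ∈ S' ↔ (1 ≤ i ∧ i ≤ N ∧ 1 ≤ j ∧ j ≤ M) ∧
        (i < x ∨ j < y ∨ (i = x ∧ j ≤ k)) := by
      intro i j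
      constructor
      · intro h
        refine ⟨hbd _ _ h, ?_⟩
        have := hnot i j h
        by_cases hi : i = x
        · subst hi; have := hkmax j h; omega
        · omega
      · rintro ⟨h, h' | h' | ⟨h', h''⟩⟩
        · exact hsub _ _ (by omega)
        · exact hsub _ _ (by omega)
        · exact hlow x k i j hk (by omega) (by omega) (by omega) (by omega)
    by_cases hkM' : k = M
    · refine ⟨chompQ N M (N + 1) 1, chomp_move_mk N M (x + 1) y (x + 1) y _ _ h2
        (chompQ_state _ _ _ _ (by omega) (by omega) (by omega) (by omega)) ?_ hr ?_ ?_, ?_⟩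
      · rw [mem_chompQ]; omega
      · intro a b; rw [mem_chompQ, hS]; omega
      · intro a b; rw [mem_chompQ, hS]; omega
      · apply chomp_full_not_win; intro a b; rw [mem_chompQ]; omega
    · refine ⟨chompQ N M x k, chomp_move_mk N M (x + 1) y (x + 1) y _ _ h2
        (chompQ_state _ _ _ _ (by omega) (by omega) (by omega) (by omega)) ?_ hr ?_ ?_, ?_⟩
      · rw [mem_chompQ]; omega
      · intro a b; rw [mem_chompQ, hS]; omega
      · intro a b; rw [mem_chompQ, hS]; omega
      · exact ih ((N - x) + (M - k)) (by omega) x k rfl (by omega) (by omega) (by omega) (by omega)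
  · have hnot : ∀ i j, (i, j) ∈ S' → ¬ (x ≤ i ∧ y + 1 ≤ j) := fun i j h ⟨p, q⟩ =>
      hc (hlow i j _ _ h hx p (by omega) q)
    have hr : (x + 1, y) ∈ S' := by
      have := hnot _ _ hp
      exact hlow i0 j0 _ _ hp (by omega) (by omega) (by omega) (by omega)
    obtain ⟨k, hk, hkmax⟩ : ∃ k, (k, y) ∈ S' ∧ ∀ j, (j, y) ∈ S' → j ≤ k := by
      classical
      refine ⟨Nat.findGreatest (fun j => (j, y) ∈ S') N, ?_, ?_⟩
      · exact Nat.findGreatest_spec (P := fun j => (j, y) ∈ S') (m := x) (by omega) hxy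
      · intro j hj
        exact Nat.le_findGreatest (hbd _ _ hj).2.1 hj
    have hxk : x + 1 ≤ k := hkmax _ hr
    have hkN := (hbd _ _ hk).2.1
    have hS : ∀ i j, (i, j) ∈ S' ↔ (1 ≤ i ∧ i ≤ N ∧ 1 ≤ j ∧ j ≤ M) ∧
        (i < x ∨ j < y ∨ (j = y ∧ i ≤ k)) := by
      intro i j
      constructor
      · intro h
        refine ⟨hbd _ _ h, ?_⟩
        have := hnot i j h
        by_cases hj : j = y
        · subst hj; have := hkmax i h; omega
        · omega
      · rintro ⟨h, h' | h' | ⟨h', h''⟩⟩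
        · exact hsub _ _ (by omega)
        · exact hsub _ _ (by omega)
        · exact hlow k y i j hk (by omega) (by omega) (by omega) (by omega)
    by_cases hkN' : k = N
    · refine ⟨chompQ N M (N + 1) 1, chomp_move_mk N M x (y + 1) x (y + 1) _ _ h2
        (chompQ_state _ _ _ _ (by omega) (by omega) (by omega) (by omega)) ?_ hc ?_ ?_, ?_⟩
      · rw [mem_chompQ]; omega
      · intro a b; rw [mem_chompQ, hS]; omega
      · intro a b; rw [mem_chompQ, hS]; omega
      · apply chomp_full_not_win; intro a b; rw [mem_chompQ]; omega
    · refine ⟨chompQ N M k y, chomp_move_mk N M x (y + 1) x (y + 1) _ _ h2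
        (chompQ_state _ _ _ _ (by omega) (by omega) (by omega) (by omega)) ?_ hc ?_ ?_, ?_⟩
      · rw [mem_chompQ]; omega
      · intro a b; rw [mem_chompQ, hS]; omega
      · intro a b; rw [mem_chompQ, hS]; omega
      · exact ih ((N - k) + (M - y)) (by omega) k y rfl (by omega) (by omega) (by omega) (by omega)

/-- For all `N, M ≥ 2`, Player 2 has a winning strategy in reversed Chomp on the
`N × M` board: the starting state `{(1,1)}` is not a first-player win. -/
theorem reversedChomp_not_firstPlayerWin (N M : ℕ) (hN : 2 ≤ N) (hM : 2 ≤ M) :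
    ¬ ChompFirstWin N M {(1, 1)} := by
  have h : chompQ N M 1 1 = {(1, 1)} := by
    ext ⟨i, j⟩
    rw [mem_chompQ, Finset.mem_singleton, Prod.mk.injEq]
    omega
  rw [← h]
  exact chompQ_not_win N M _ 1 1 rfl (by omega) (by omega) (by omega) (by omega)
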